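/- If a finite set of nodes A ⊆ |△̄| is poised for S(△̄), where △̄ is a strip of n triangles, then #A = n+2, i.e., every poised problem is exact. -/

import Mathlib

open scoped Classical

noncomputable section

/-- Points of the plane. -/
abbrev E : Type := ℝ × ℝ

/-- The closed triangle `Δᵢ` with vertices `V i`, `V (i+1)`, `V (i+2)`. -/
def tri (V : ℕ → E) (i : ℕ) : Set E :=
  convexHull ℝ {V i, V (i + 1), V (i + 2)}

/-- `V 1, …, V (n+2)` are the vertices of a strip of `n` triangles
`Δ₁, …, Δₙ`, where `Δᵢ = [Vᵢ, Vᵢ₊₁, Vᵢ₊₂]`. -/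
structure IsStrip (n : ℕ) (V : ℕ → E) : Prop where
  indep : ∀ i, 1 ≤ i → i ≤ n → AffineIndependent ℝ ![V i, V (i + 1), V (i + 2)]
  adj : ∀ i, 1 ≤ i → i + 1 ≤ n →
    tri V i ∩ tri V (i + 1) = segment ℝ (V (i + 1)) (V (i + 2))
  touch : ∀ i, 1 ≤ i → i + 2 ≤ n → tri V i ∩ tri V (i + 2) = {V (i + 2)}
  disj : ∀ i j, 1 ≤ i → j ≤ n → i + 3 ≤ j → tri V i ∩ tri V j = ∅

/-- The underlying set `|△̄ₖᵐ|` of the (sub)strip consisting of the triangles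
`Δ k, …, Δ m`. -/
def stripSet (V : ℕ → E) (k m : ℕ) : Set E :=
  ⋃ i ∈ Finset.Icc k m, tri V i

/-- The space `S(△̄ₖᵐ)` of continuous functions on the strip `|△̄ₖᵐ|` whose
restriction to each triangle `Δᵢ`, `k ≤ i ≤ m`, agrees with an affine
function `ℝ² → ℝ`. -/
def stripSpace (V : ℕ → E) (k m : ℕ) : Submodule ℝ (stripSet V k m → ℝ) where
  carrier := {s | Continuous s ∧ ∀ i ∈ Finset.Icc k m, ∃ f : E →ᵃ[ℝ] ℝ,
    ∀ x : stripSet V k m, (x : E) ∈ tri V i → s x = f x}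
  add_mem' := by
    rintro a b ⟨hca, ha⟩ ⟨hcb, hb⟩
    refine ⟨hca.add hcb, fun i hi => ?_⟩
    obtain ⟨f, hf⟩ := ha i hi
    obtain ⟨g, hg⟩ := hb i hi
    exact ⟨f + g, fun x hx => by simp [hf x hx, hg x hx]⟩
  zero_mem' := ⟨continuous_const, fun i hi => ⟨0, fun x hx => by simp⟩⟩
  smul_mem' := by
    rintro c a ⟨hca, ha⟩
    refine ⟨hca.const_smul c, fun i hi => ?_⟩
    obtain ⟨f, hf⟩ := ha i hi
    exact ⟨c • f, fun x hx => by simp [hf x hx]⟩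

/-- Poisedness of a node set `A` for a subspace `T` of the functions on the
strip `|△̄ₖᵐ|`: for every data `c` there is a unique `s ∈ T` interpolating
`c` at the nodes. -/
def PoisedFor (V : ℕ → E) (k m : ℕ) (T : Submodule ℝ (stripSet V k m → ℝ))
    (A : Finset E) : Prop :=
  ∀ c : E → ℝ, ∃! s : stripSet V k m → ℝ,
    s ∈ T ∧ ∀ a : stripSet V k m, (a : E) ∈ A → s a = c a

/-- Poisedness of the interpolation problem `{△̄ₖᵐ, A}`. -/
def Poised (V : ℕ → E) (k m : ℕ) (A : Finset E) : Prop :=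
  PoisedFor V k m (stripSpace V k m) A

/-- The node set `Aₖᵐ = A ∩ |△̄ₖᵐ|` of the subproblem `{△̄, A}ₖᵐ`. -/
def nodesIn (V : ℕ → E) (k m : ℕ) (A : Finset E) : Finset E :=
  A.filter (fun x => x ∈ stripSet V k m)

/-- The nodes of `A` lying in the triangle `Δᵢ`. -/
def triNodes (V : ℕ → E) (i : ℕ) (A : Finset E) : Finset E :=
  A.filter (fun x => x ∈ tri V i)

/-- Prescribed values at three affinely independent points of the plane are attained by an
affine function. -/
lemma exists_affineMap_apply_eq {p : Fin 3 → E} (hp : AffineIndependent ℝ p) (c : Fin 3 → ℝ) :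
    ∃ f : E →ᵃ[ℝ] ℝ, ∀ j, f (p j) = c j := by
  have hs : affineSpan ℝ (Set.range p) = ⊤ := by
    rw [hp.affineSpan_eq_top_iff_card_eq_finrank_add_one]
    simp
  let b : AffineBasis (Fin 3) ℝ E := ⟨p, hp, hs⟩
  refine ⟨∑ i, c i • b.coord i, fun j => ?_⟩
  have hb : ∀ i, b.coord i (p j) = if i = j then 1 else 0 := fun i => b.coord_apply i j
  rw [Fin.sum_univ_three]
  simp only [AffineMap.coe_add, AffineMap.coe_smul, Pi.add_apply, Pi.smul_apply, hb]
  fin_cases j <;> simp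

/-- Two affine functions that agree on a set agree on its convex hull. -/
lemma eqOn_convexHull {f g : E →ᵃ[ℝ] ℝ} {s : Set E} (h : Set.EqOn f g s) :
    Set.EqOn f g (convexHull ℝ s) := by
  have hc : Convex ℝ {x | f x = g x} := by
    have : {x | f x = g x} = (f - g) ⁻¹' {0} := by
      ext x
      simp [sub_eq_zero]
    rw [this]
    exact (convex_singleton (0 : ℝ)).affine_preimage (f - g)
  exact fun x hx => convexHull_min h hc hx

lemma isClosed_tri (V : ℕ → E) (i : ℕ) : IsClosed (tri V i) :=
  (Set.toFinite {V i, V (i + 1), V (i + 2)}).isClosed_convexHull ℝ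

lemma left_mem_tri (V : ℕ → E) (i : ℕ) : V i ∈ tri V i :=
  subset_convexHull ℝ _ (by simp)

lemma middle_mem_tri (V : ℕ → E) (i : ℕ) : V (i + 1) ∈ tri V i :=
  subset_convexHull ℝ _ (by simp)

lemma right_mem_tri (V : ℕ → E) (i : ℕ) : V (i + 2) ∈ tri V i :=
  subset_convexHull ℝ _ (by simp)

lemma mem_stripSet {V : ℕ → E} {k m : ℕ} {x : E} :
    x ∈ stripSet V k m ↔ ∃ i, (k ≤ i ∧ i ≤ m) ∧ x ∈ tri V i := by
  simp [stripSet]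

lemma vertex_mem_stripSet {n : ℕ} (hn : 1 ≤ n) (V : ℕ → E) {k : ℕ} (hk : 1 ≤ k)
    (hkn : k ≤ n + 2) : V k ∈ stripSet V 1 n := by
  rw [mem_stripSet]
  rcases (by omega : k ≤ n ∨ k = n + 1 ∨ k = n + 2) with h | rfl | rfl
  · exact ⟨k, ⟨hk, h⟩, left_mem_tri V k⟩
  · exact ⟨n, ⟨hn, le_rfl⟩, middle_mem_tri V n⟩
  · exact ⟨n, ⟨hn, le_rfl⟩, right_mem_tri V n⟩

/-- Affine functions on the triangles of a strip that take common values at the vertices agree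
wherever two triangles meet. -/
lemma IsStrip.apply_eq_of_mem {n : ℕ} {V : ℕ → E} (hV : IsStrip n V) {c : ℕ → ℝ}
    {f : ℕ → E →ᵃ[ℝ] ℝ}
    (hf : ∀ i, 1 ≤ i → i ≤ n →
      f i (V i) = c i ∧ f i (V (i + 1)) = c (i + 1) ∧ f i (V (i + 2)) = c (i + 2))
    {i j : ℕ} (hi : 1 ≤ i) (hij : i ≤ j) (hj : j ≤ n) {x : E} (hxi : x ∈ tri V i)
    (hxj : x ∈ tri V j) : f i x = f j x := by
  obtain ⟨-, hi₁, hi₂⟩ := hf i hi (hij.trans hj)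
  obtain ⟨hj₀, hj₁, -⟩ := hf j (hi.trans hij) hj
  rcases (by omega : j = i ∨ j = i + 1 ∨ j = i + 2 ∨ i + 3 ≤ j) with rfl | rfl | rfl | h
  · rfl
  · have hx : x ∈ segment ℝ (V (i + 1)) (V (i + 2)) := hV.adj i hi hj ▸ ⟨hxi, hxj⟩
    rw [← convexHull_pair] at hx
    refine eqOn_convexHull ?_ hx
    rintro y (rfl | rfl)
    · rw [hi₁, hj₀]
    · rw [hi₂, hj₁]
  · have hx : x ∈ ({V (i + 2)} : Set E) := hV.touch i hi hj ▸ ⟨hxi, hxj⟩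
    rw [Set.mem_singleton_iff.1 hx, hi₂, hj₀]
  · have hx : x ∈ (∅ : Set E) := hV.disj i j hi hj h ▸ ⟨hxi, hxj⟩
    exact hx.elim

/-- Arbitrary values at the vertices of a strip are attained by an element of the spline space. -/
lemma IsStrip.exists_mem_stripSpace {n : ℕ} {V : ℕ → E} (hV : IsStrip n V) (c : ℕ → ℝ) :
    ∃ s ∈ stripSpace V 1 n, ∀ i, 1 ≤ i → i ≤ n → ∀ x : stripSet V 1 n,
      ((x : E) = V i → s x = c i) ∧ ((x : E) = V (i + 1) → s x = c (i + 1)) ∧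
        ((x : E) = V (i + 2) → s x = c (i + 2)) := by
  have hex : ∀ i, ∃ f : E →ᵃ[ℝ] ℝ, 1 ≤ i → i ≤ n →
      f (V i) = c i ∧ f (V (i + 1)) = c (i + 1) ∧ f (V (i + 2)) = c (i + 2) := by
    intro i
    by_cases h : 1 ≤ i ∧ i ≤ n
    · obtain ⟨f, hf⟩ := exists_affineMap_apply_eq (hV.indep i h.1 h.2)
        ![c i, c (i + 1), c (i + 2)]
      exact ⟨f, fun _ _ => ⟨hf 0, hf 1, hf 2⟩⟩
    · exact ⟨0, fun h₁ h₂ => (h ⟨h₁, h₂⟩).elim⟩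
  choose f hf using hex
  choose t ht htri using fun x : stripSet V 1 n => mem_stripSet.1 x.2
  have hs : ∀ i, 1 ≤ i → i ≤ n → ∀ x : stripSet V 1 n, (x : E) ∈ tri V i →
      f (t x) x = f i x := by
    intro i hi hin x hx
    rcases le_total i (t x) with h | h
    · exact (hV.apply_eq_of_mem hf hi h (ht x).2 hx (htri x)).symm
    · exact hV.apply_eq_of_mem hf (ht x).1 h hin (htri x) hx
  refine ⟨fun x => f (t x) x, ⟨?_, ?_⟩, ?_⟩
  · refine (locallyFinite_of_finite
      (fun i : Finset.Icc 1 n => ((↑) : stripSet V 1 n → E) ⁻¹' tri V i)).continuous ?_ ?_ ?_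
    · refine Set.eq_univ_of_forall fun x => Set.mem_iUnion.2 ?_
      exact ⟨⟨t x, Finset.mem_Icc.2 (ht x)⟩, htri x⟩
    · exact fun i => (isClosed_tri V i).preimage continuous_subtype_val
    · rintro ⟨i, hi⟩
      rw [Finset.mem_Icc] at hi
      exact ((f i).continuous_of_finiteDimensional.comp
        continuous_subtype_val).continuousOn.congr fun x hx => hs i hi.1 hi.2 x hx
  · intro i hi
    rw [Finset.mem_Icc] at hi
    exact ⟨f i, hs i hi.1 hi.2⟩
  · intro i hi hin x
    obtain ⟨h₀, h₁, h₂⟩ := hf i hi hin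
    refine ⟨fun hx => ?_, fun hx => ?_, fun hx => ?_⟩
    · rw [← h₀, ← hx]
      exact hs i hi hin x (hx ▸ left_mem_tri V i)
    · rw [← h₁, ← hx]
      exact hs i hi hin x (hx ▸ middle_mem_tri V i)
    · rw [← h₂, ← hx]
      exact hs i hi hin x (hx ▸ right_mem_tri V i)

/-- An element of the spline space that vanishes at all vertices vanishes. -/
lemma eq_zero_of_vertices {n : ℕ} {V : ℕ → E} {s : stripSet V 1 n → ℝ}
    (hs : s ∈ stripSpace V 1 n)
    (h : ∀ k, 1 ≤ k → k ≤ n + 2 → ∀ x : stripSet V 1 n, (x : E) = V k → s x = 0) : s = 0 := by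
  funext x
  obtain ⟨i, hi, hx⟩ := mem_stripSet.1 x.2
  obtain ⟨f, hf⟩ := hs.2 i (Finset.mem_Icc.2 hi)
  have hv : ∀ k, 1 ≤ k → k ≤ n + 2 → V k ∈ tri V i → f (V k) = 0 := by
    intro k hk hkn hki
    have hmem : V k ∈ stripSet V 1 n := mem_stripSet.2 ⟨i, hi, hki⟩
    rw [← h k hk hkn ⟨V k, hmem⟩ rfl]
    exact (hf ⟨V k, hmem⟩ hki).symm
  have h0 : Set.EqOn f (0 : E →ᵃ[ℝ] ℝ) {V i, V (i + 1), V (i + 2)} := by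
    rintro y (rfl | rfl | rfl)
    · exact hv i (by omega) (by omega) (left_mem_tri V i)
    · exact hv (i + 1) (by omega) (by omega) (middle_mem_tri V i)
    · exact hv (i + 2) (by omega) (by omega) (right_mem_tri V i)
  rw [hf x hx]
  exact eqOn_convexHull h0 hx

/-- Evaluation of the elements of the spline space at a family of points of the strip. -/
def evalAt (V : ℕ → E) (k m : ℕ) {ι : Type*} (p : ι → stripSet V k m) :
    stripSpace V k m →ₗ[ℝ] (ι → ℝ) :=
  (LinearMap.funLeft ℝ ℝ p).comp (stripSpace V k m).subtype

lemma IsStrip.finrank_stripSpace {n : ℕ} (hn : 1 ≤ n) {V : ℕ → E} (hV : IsStrip n V) :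
    Module.finrank ℝ (stripSpace V 1 n) = n + 2 := by
  let p : Fin (n + 2) → stripSet V 1 n := fun k =>
    ⟨V (k + 1), vertex_mem_stripSet hn V (by omega) (by omega)⟩
  have hbij : Function.Bijective (evalAt V 1 n p) := by
    constructor
    · rw [injective_iff_map_eq_zero]
      intro s hs
      refine Subtype.ext (eq_zero_of_vertices s.2 fun k hk hkn x hx => ?_)
      have hxp : x = p ⟨k - 1, by omega⟩ := by
        refine Subtype.ext (hx.trans ?_)
        change V k = V (k - 1 + 1)
        rw [Nat.sub_add_cancel hk]
      rw [hxp]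
      exact congrFun hs ⟨k - 1, by omega⟩
    · intro c
      obtain ⟨s, hs, hsc⟩ := hV.exists_mem_stripSpace
        fun k => if h : k - 1 < n + 2 then c ⟨k - 1, h⟩ else 0
      refine ⟨⟨s, hs⟩, funext fun k => ?_⟩
      change s (p k) = c k
      have hk : (if h : (k : ℕ) + 1 - 1 < n + 2 then c ⟨(k : ℕ) + 1 - 1, h⟩ else 0) = c k := by
        simp
      rw [← hk]
      obtain ⟨k, hkn⟩ := k
      rcases (by omega : k + 1 ≤ n ∨ k = n ∨ k = n + 1) with h | rfl | rfl
      · exact (hsc (k + 1) (by omega) h _).1 rfl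
      · exact (hsc k hn le_rfl _).2.1 rfl
      · exact (hsc n hn le_rfl _).2.2 rfl
  simpa using (LinearEquiv.ofBijective _ hbij).finrank_eq

lemma Poised.card_eq_finrank {V : ℕ → E} {k m : ℕ} {A : Finset E}
    (hA : ↑A ⊆ stripSet V k m) (hp : Poised V k m A) :
    A.card = Module.finrank ℝ (stripSpace V k m) := by
  let p : A → stripSet V k m := fun a => ⟨a, hA a.2⟩
  have hbij : Function.Bijective (evalAt V k m p) := by
    constructor
    · rw [injective_iff_map_eq_zero]
      intro s hs
      exact Subtype.ext ((hp 0).unique ⟨s.2, fun a ha => congrFun hs ⟨a, ha⟩⟩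
        ⟨zero_mem _, fun _ _ => rfl⟩)
    · intro c
      obtain ⟨s, ⟨hs, hsc⟩, -⟩ := hp fun x => if h : x ∈ A then c ⟨x, h⟩ else 0
      refine ⟨⟨s, hs⟩, funext fun a => ?_⟩
      exact (hsc (p a) a.2).trans (dif_pos a.2)
  simpa using (LinearEquiv.ofBijective _ hbij).finrank_eq.symm

/-- Any poised node set for `S(△̄)`, where `△̄` is a strip of `n`
triangles, has exactly `n + 2` nodes; i.e. every poised problem is exact. -/
theorem poised_card (n : ℕ) (hn : 1 ≤ n) (V : ℕ → E) (hV : IsStrip n V)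
    (A : Finset E) (hA : ↑A ⊆ stripSet V 1 n) (hp : Poised V 1 n A) :
    A.card = n + 2 := by
  rw [hp.card_eq_finrank hA, hV.finrank_stripSpace hn]
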